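/- Let N be a positive integer, A and B real n×n matrices, Q_k symmetric positive definite n×n matrices for k = 0,…,N, and Σ_k symmetric positive definite n×n matrices for k = 0,…,N−1. Define Z backward by Z(N,x) = exp(−½ xᵀQ_N x) and Z(k,x) = exp(−½ xᵀQ_k x) ∫_{ℝⁿ} Z(k+1, Ax + Bu) N(u | 0, Σ_k) du, and define P_k by the Riccati difference equation P_N = Q_N, P_k = Q_k + AᵀP_{k+1}A − AᵀP_{k+1}B(Σ_k^{−1} + BᵀP_{k+1}B)^{−1}BᵀP_{k+1}A. Then for each k ∈ {0,…,N−1} and each x ∈ ℝⁿ, the probability measure on ℝⁿ whose density is proportional to u ↦ N(u | 0, Σ_k) · Z(k+1, Ax + Bu) is the Gaussian measure with mean −(Σ_k^{−1} + BᵀP_{k+1}B)^{−1} BᵀP_{k+1} A x and covariance (Σ_k^{−1} + BᵀP_{k+1}B)^{−1}; i.e., the optimal KL-control policy is the LQR feedback controller perturbed by zero-mean Gaussian noise with covariance (Σ_k^{−1} + BᵀP_{k+1}B)^{−1}. -/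

import Mathlib

open Matrix MeasureTheory

/- The `n`-dimensional Gaussian density `N(x | m, S)` for positive definite `S`. -/
noncomputable def gaussDensity {n : ℕ} (m : Fin n → ℝ) (S : Matrix (Fin n) (Fin n) ℝ)
    (x : Fin n → ℝ) : ℝ :=
  (Real.sqrt ((2 * Real.pi) ^ n * S.det))⁻¹ *
    Real.exp (-(1 / 2) * ((x - m) ⬝ᵥ S⁻¹.mulVec (x - m)))

theorem dot_tr {n : ℕ} (A : Matrix (Fin n) (Fin n) ℝ) (x y : Fin n → ℝ) :
    x ⬝ᵥ (Aᵀ *ᵥ y) = (A *ᵥ x) ⬝ᵥ y := by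
  rw [dotProduct_mulVec, vecMul_transpose]

theorem dot_symm {n : ℕ} (M : Matrix (Fin n) (Fin n) ℝ) (h : Mᵀ = M) (x y : Fin n → ℝ) :
    x ⬝ᵥ (M *ᵥ y) = y ⬝ᵥ (M *ᵥ x) := by
  rw [dotProduct_comm, ← dot_tr, h]

theorem posDef_tr {n : ℕ} {M : Matrix (Fin n) (Fin n) ℝ} (h : M.PosDef) : Mᵀ = M := by
  have := h.isHermitian.eq
  rwa [conjTranspose_eq_transpose_of_trivial] at this

theorem posDef_M {n : ℕ} (B S P : Matrix (Fin n) (Fin n) ℝ) (hS : S.PosDef) (hP : P.PosDef) :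
    (S⁻¹ + Bᵀ * P * B).PosDef := by
  have h := hP.posSemidef.conjTranspose_mul_mul_same B
  rw [conjTranspose_eq_transpose_of_trivial] at h
  exact hS.inv.add_posSemidef h

theorem complete_sq {n : ℕ} (A B S P : Matrix (Fin n) (Fin n) ℝ) (hS : S.PosDef) (hP : P.PosDef)
    (x u : Fin n → ℝ) :
    u ⬝ᵥ S⁻¹ *ᵥ u + (A *ᵥ x + B *ᵥ u) ⬝ᵥ P *ᵥ (A *ᵥ x + B *ᵥ u) =
      (u + ((S⁻¹ + Bᵀ * P * B)⁻¹ * (Bᵀ * P * A)) *ᵥ x) ⬝ᵥ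
        (S⁻¹ + Bᵀ * P * B) *ᵥ (u + ((S⁻¹ + Bᵀ * P * B)⁻¹ * (Bᵀ * P * A)) *ᵥ x) +
      x ⬝ᵥ (Aᵀ * P * A - Aᵀ * P * B * (S⁻¹ + Bᵀ * P * B)⁻¹ * Bᵀ * P * A) *ᵥ x := by
  have hM := posDef_M B S P hS hP
  have hu : u ⬝ᵥ (S⁻¹ + Bᵀ * P * B) *ᵥ u = u ⬝ᵥ S⁻¹ *ᵥ u + (B *ᵥ u) ⬝ᵥ P *ᵥ (B *ᵥ u) := by
    rw [add_mulVec, dotProduct_add, ← mulVec_mulVec, ← mulVec_mulVec, dot_tr]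
  generalize hMM : S⁻¹ + Bᵀ * P * B = M at *
  have hMi : M * M⁻¹ = 1 := mul_nonsing_inv _ ((isUnit_iff_isUnit_det _).1 hM.isUnit)
  have hPt := posDef_tr hP
  have hMt := posDef_tr hM
  set v := (M⁻¹ * (Bᵀ * P * A)) *ᵥ x with hv
  have hMv : M *ᵥ v = Bᵀ *ᵥ (P *ᵥ (A *ᵥ x)) := by
    rw [hv, mulVec_mulVec, ← mul_assoc M, hMi, one_mul, ← mulVec_mulVec, ← mulVec_mulVec]
  have hR : x ⬝ᵥ (Aᵀ * P * A - Aᵀ * P * B * M⁻¹ * Bᵀ * P * A) *ᵥ x =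
      (A *ᵥ x) ⬝ᵥ P *ᵥ (A *ᵥ x) - (A *ᵥ x) ⬝ᵥ P *ᵥ (B *ᵥ v) := by
    rw [sub_mulVec, dotProduct_sub, hv]
    simp only [← mulVec_mulVec, dot_tr]
  rw [hR]
  simp only [mulVec_add, add_dotProduct, dotProduct_add, hMv, hu]
  rw [dot_symm M hMt v u, hMv]
  simp only [dot_tr]
  rw [dot_symm P hPt (A *ᵥ x) (B *ᵥ u), dot_symm P hPt (A *ᵥ x) (B *ᵥ v)]
  ring

theorem posDef_R {n : ℕ} (A B S P Q : Matrix (Fin n) (Fin n) ℝ) (hS : S.PosDef) (hP : P.PosDef)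
    (hQ : Q.PosDef) :
    (Q + Aᵀ * P * A - Aᵀ * P * B * (S⁻¹ + Bᵀ * P * B)⁻¹ * Bᵀ * P * A).PosDef := by
  rw [add_sub_assoc]
  apply hQ.add_posSemidef
  have hM := posDef_M B S P hS hP
  have hPt := posDef_tr hP
  have hMt := posDef_tr hM
  refine PosSemidef.of_dotProduct_mulVec_nonneg ?_ ?_
  · rw [IsHermitian, conjTranspose_eq_transpose_of_trivial]
    simp only [transpose_sub, transpose_mul, transpose_transpose, hPt, transpose_nonsing_inv, hMt]
    simp only [mul_assoc]
  · intro x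
    have h := complete_sq A B S P hS hP x
      (-(((S⁻¹ + Bᵀ * P * B)⁻¹ * (Bᵀ * P * A)) *ᵥ x))
    rw [neg_add_cancel, zero_dotProduct, zero_add] at h
    rw [star_trivial, ← h]
    have h1 := hS.inv.posSemidef.dotProduct_mulVec_nonneg
      (-(((S⁻¹ + Bᵀ * P * B)⁻¹ * (Bᵀ * P * A)) *ᵥ x))
    have h2 := hP.posSemidef.dotProduct_mulVec_nonneg
      (A *ᵥ x + B *ᵥ (-(((S⁻¹ + Bᵀ * P * B)⁻¹ * (Bᵀ * P * A)) *ᵥ x)))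
    rw [star_trivial] at h1 h2
    exact add_nonneg h1 h2

theorem exp_split {n : ℕ} (A B S P : Matrix (Fin n) (Fin n) ℝ) (hS : S.PosDef) (hP : P.PosDef)
    (x u : Fin n → ℝ) :
    Real.exp (-(1 / 2) * (u ⬝ᵥ S⁻¹ *ᵥ u)) *
      Real.exp (-(1 / 2) * ((A *ᵥ x + B *ᵥ u) ⬝ᵥ P *ᵥ (A *ᵥ x + B *ᵥ u))) =
    Real.exp (-(1 / 2) * (x ⬝ᵥ (Aᵀ * P * A - Aᵀ * P * B * (S⁻¹ + Bᵀ * P * B)⁻¹ * Bᵀ * P * A) *ᵥ x)) *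
    Real.exp (-(1 / 2) * ((u + ((S⁻¹ + Bᵀ * P * B)⁻¹ * (Bᵀ * P * A)) *ᵥ x) ⬝ᵥ
        (S⁻¹ + Bᵀ * P * B) *ᵥ (u + ((S⁻¹ + Bᵀ * P * B)⁻¹ * (Bᵀ * P * A)) *ᵥ x))) := by
  rw [← Real.exp_add, ← Real.exp_add, ← mul_add, complete_sq A B S P hS hP, ← mul_add, add_comm]

/-- The optimal KL-control policy in the LQG setting: the density proportional to
`u ↦ N(u|0,Σ_k)·Z(k+1, Ax+Bu)` is the Gaussian density of the LQR feedback controller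
perturbed by zero-mean Gaussian noise with covariance `(Σ_k⁻¹ + BᵀP_{k+1}B)⁻¹`. -/
theorem stmt_16 {n : ℕ} (N : ℕ) (hN : 0 < N) (A B : Matrix (Fin n) (Fin n) ℝ)
    (Q : ℕ → Matrix (Fin n) (Fin n) ℝ) (hQ : ∀ k ≤ N, (Q k).PosDef)
    (Sg : ℕ → Matrix (Fin n) (Fin n) ℝ) (hSg : ∀ k < N, (Sg k).PosDef)
    (Z : ℕ → (Fin n → ℝ) → ℝ)
    (hZN : ∀ x, Z N x = Real.exp (-(1 / 2) * (x ⬝ᵥ (Q N).mulVec x)))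
    (hZk : ∀ k < N, ∀ x, Z k x = Real.exp (-(1 / 2) * (x ⬝ᵥ (Q k).mulVec x)) *
      ∫ u : Fin n → ℝ, Z (k + 1) (A.mulVec x + B.mulVec u) * gaussDensity 0 (Sg k) u)
    (P : ℕ → Matrix (Fin n) (Fin n) ℝ)
    (hPN : P N = Q N)
    (hPk : ∀ k < N, P k = Q k + Aᵀ * P (k + 1) * A -
      Aᵀ * P (k + 1) * B * ((Sg k)⁻¹ + Bᵀ * P (k + 1) * B)⁻¹ * Bᵀ * P (k + 1) * A) :
    ∀ k < N, ((Sg k)⁻¹ + Bᵀ * P (k + 1) * B).PosDef ∧ ∀ x : Fin n → ℝ,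
      ∃ C : ℝ, ∀ u : Fin n → ℝ,
        gaussDensity 0 (Sg k) u * Z (k + 1) (A.mulVec x + B.mulVec u) =
          C * gaussDensity
              (-((((Sg k)⁻¹ + Bᵀ * P (k + 1) * B)⁻¹ * (Bᵀ * P (k + 1) * A)).mulVec x))
              (((Sg k)⁻¹ + Bᵀ * P (k + 1) * B)⁻¹) u := by
  have key : ∀ j ≤ N, (P (N - j)).PosDef ∧ ∃ c : ℝ, ∀ x, Z (N - j) x =
      c * Real.exp (-(1 / 2) * (x ⬝ᵥ (P (N - j)).mulVec x)) := by
    intro j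
    induction j with
    | zero =>
      intro _
      rw [Nat.sub_zero, hPN]
      exact ⟨hQ N le_rfl, 1, fun x => by rw [hZN, one_mul]⟩
    | succ j ih =>
      intro hj
      obtain ⟨hP, c, hc⟩ := ih (by omega)
      have hk : N - (j + 1) < N := by omega
      have hk1 : N - j = N - (j + 1) + 1 := by omega
      rw [hk1] at hP hc
      generalize N - (j + 1) = k at *
      have hS := hSg k hk
      rw [hPk k hk]
      refine ⟨posDef_R _ _ _ _ _ hS hP (hQ k hk.le), ?_⟩
      refine ⟨c * (Real.sqrt ((2 * Real.pi) ^ n * (Sg k).det))⁻¹ *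
        ∫ u : Fin n → ℝ, Real.exp (-(1 / 2) * (u ⬝ᵥ ((Sg k)⁻¹ + Bᵀ * P (k + 1) * B) *ᵥ u)), ?_⟩
      intro x
      have h1 : ∀ u : Fin n → ℝ, Z (k + 1) (A.mulVec x + B.mulVec u) * gaussDensity 0 (Sg k) u =
          (c * (Real.sqrt ((2 * Real.pi) ^ n * (Sg k).det))⁻¹ *
            Real.exp (-(1 / 2) * (x ⬝ᵥ (Aᵀ * P (k + 1) * A - Aᵀ * P (k + 1) * B *
              ((Sg k)⁻¹ + Bᵀ * P (k + 1) * B)⁻¹ * Bᵀ * P (k + 1) * A) *ᵥ x))) *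
          (fun w : Fin n → ℝ =>
            Real.exp (-(1 / 2) * (w ⬝ᵥ ((Sg k)⁻¹ + Bᵀ * P (k + 1) * B) *ᵥ w)))
            (u + (((Sg k)⁻¹ + Bᵀ * P (k + 1) * B)⁻¹ * (Bᵀ * P (k + 1) * A)) *ᵥ x) := by
        intro u
        have h := exp_split A B (Sg k) (P (k + 1)) hS hP x u
        simp only [gaussDensity, sub_zero, hc]
        linear_combination c * (Real.sqrt ((2 * Real.pi) ^ n * (Sg k).det))⁻¹ * h
      rw [hZk k hk]
      rw [integral_congr_ae (Filter.Eventually.of_forall h1), integral_const_mul, integral_add_right_eq_self (fun w : Fin n → ℝ =>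
            Real.exp (-(1 / 2) * (w ⬝ᵥ ((Sg k)⁻¹ + Bᵀ * P (k + 1) * B) *ᵥ w))), add_sub_assoc (Q k), add_mulVec,
        dotProduct_add, mul_add, Real.exp_add]
      ring
  intro k hk
  obtain ⟨hP, c, hc⟩ := key (N - (k + 1)) (by omega)
  rw [show N - (N - (k + 1)) = k + 1 by omega] at hP hc
  have hS := hSg k hk
  have hM := posDef_M B (Sg k) (P (k + 1)) hS hP
  refine ⟨hM, fun x => ?_⟩
  have hne : Real.sqrt ((2 * Real.pi) ^ n * (((Sg k)⁻¹ + Bᵀ * P (k + 1) * B)⁻¹).det) ≠ 0 := by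
    have := hM.inv.det_pos
    positivity
  refine ⟨Real.sqrt ((2 * Real.pi) ^ n * (((Sg k)⁻¹ + Bᵀ * P (k + 1) * B)⁻¹).det) *
    (c * (Real.sqrt ((2 * Real.pi) ^ n * (Sg k).det))⁻¹ *
            Real.exp (-(1 / 2) * (x ⬝ᵥ (Aᵀ * P (k + 1) * A - Aᵀ * P (k + 1) * B *
              ((Sg k)⁻¹ + Bᵀ * P (k + 1) * B)⁻¹ * Bᵀ * P (k + 1) * A) *ᵥ x))), fun u => ?_⟩
  have h := exp_split A B (Sg k) (P (k + 1)) hS hP x u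
  simp only [gaussDensity, sub_zero, hc, sub_neg_eq_add]
  rw [nonsing_inv_nonsing_inv _ ((isUnit_iff_isUnit_det _).1 hM.isUnit)]
  have e : ∀ s t a : ℝ, s ≠ 0 → s * t * (s⁻¹ * a) = t * a := by
    intro s t a hs
    field_simp
  rw [e _ _ _ hne]
  linear_combination c * (Real.sqrt ((2 * Real.pi) ^ n * (Sg k).det))⁻¹ * h
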